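/- arXiv:1610.00199 — 3 statements merged into one kernel-verified Lean document; each statement's English description precedes it below -/
import Mathlib

section
/- Let U be an n×d real matrix with orthonormal columns (UᵀU = I_d), let w ∈ ℝ^d with w ≠ 0, set p = Uw, and let r ∈ ℝ^n satisfy Uᵀr = 0 and r ≠ 0. Then for every angle θ ∈ ℝ, the GROUSE update U₊(θ) := U + (cos θ · p/‖p‖ + sin θ · r/‖r‖ − p/‖p‖) wᵀ/‖w‖ again has orthonormal columns, i.e. U₊(θ)ᵀ U₊(θ) = I_d. -/
open Matrix

/-- The Euclidean (ℓ²) norm of a vector in `ℝ^k`. -/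
noncomputable def l2norm {k : ℕ} (v : Fin k → ℝ) : ℝ := Real.sqrt (∑ i, v i ^ 2)

theorem l2norm_sq {k : ℕ} (v : Fin k → ℝ) : l2norm v ^ 2 = v ⬝ᵥ v := by
  rw [l2norm, Real.sq_sqrt (Finset.sum_nonneg fun i _ => sq_nonneg _)]
  simp [dotProduct, sq]

theorem l2norm_ne_zero {k : ℕ} {v : Fin k → ℝ} (hv : v ≠ 0) : l2norm v ≠ 0 := by
  intro h
  apply hv
  rw [← dotProduct_self_eq_zero, ← l2norm_sq, h]
  simp

theorem inv_l2norm_smul_dotProduct_self {k : ℕ} {v : Fin k → ℝ} (hv : v ≠ 0) :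
    ((l2norm v)⁻¹ • v) ⬝ᵥ ((l2norm v)⁻¹ • v) = 1 := by
  have h := l2norm_ne_zero hv
  rw [smul_dotProduct, dotProduct_smul, ← l2norm_sq, smul_eq_mul, smul_eq_mul]
  field_simp

theorem mulVec_dotProduct_mulVec_of_orthonormal {n d : ℕ} {U : Matrix (Fin n) (Fin d) ℝ}
    (hU : Uᵀ * U = 1) (v w : Fin d → ℝ) : U *ᵥ v ⬝ᵥ U *ᵥ w = v ⬝ᵥ w := by
  rw [dotProduct_mulVec, vecMul_mulVec, hU, vecMul_one]

theorem l2norm_mulVec_of_orthonormal {n d : ℕ} {U : Matrix (Fin n) (Fin d) ℝ}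
    (hU : Uᵀ * U = 1) (w : Fin d → ℝ) : l2norm (U *ᵥ w) = l2norm w := by
  have h := mulVec_dotProduct_mulVec_of_orthonormal hU w w
  rw [← l2norm_sq, ← l2norm_sq] at h
  exact (sq_eq_sq₀ (Real.sqrt_nonneg _) (Real.sqrt_nonneg _)).1 h

/-- Replacing the direction `U b` in the column space of `U` by the unit vector `c • U b + s • q`,
where `q` is a unit vector orthogonal to that space, keeps the columns orthonormal. -/
theorem rotate_column_direction_orthonormal {n d : ℕ} {U : Matrix (Fin n) (Fin d) ℝ}
    (hU : Uᵀ * U = 1) {b : Fin d → ℝ} (hb : b ⬝ᵥ b = 1) {q : Fin n → ℝ} (hUq : Uᵀ *ᵥ q = 0)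
    (hq : q ⬝ᵥ q = 1) {c s : ℝ} (hcs : c ^ 2 + s ^ 2 = 1) :
    (U + vecMulVec ((c - 1) • U *ᵥ b + s • q) b)ᵀ *
      (U + vecMulVec ((c - 1) • U *ᵥ b + s • q) b) = 1 := by
  set a := (c - 1) • U *ᵥ b + s • q with ha
  have hUa : Uᵀ *ᵥ a = (c - 1) • b := by
    rw [ha, mulVec_add, mulVec_smul, mulVec_smul, hUq, mulVec_mulVec, hU, one_mulVec]
    simp
  have haU : a ᵥ* U = (c - 1) • b := by rw [← mulVec_transpose, hUa]
  have hbq : U *ᵥ b ⬝ᵥ q = 0 := by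
    rw [dotProduct_comm, dotProduct_mulVec, ← mulVec_transpose, hUq, zero_dotProduct]
  have haa : a ⬝ᵥ a = 2 - 2 * c := by
    have hqb : q ⬝ᵥ U *ᵥ b = 0 := by rw [dotProduct_comm, hbq]
    simp only [ha, add_dotProduct, dotProduct_add, smul_dotProduct, dotProduct_smul, hbq, hqb, hq,
      mulVec_dotProduct_mulVec_of_orthonormal hU, hb, smul_eq_mul]
    linear_combination hcs
  rw [transpose_add, transpose_vecMulVec, Matrix.add_mul, Matrix.mul_add, Matrix.mul_add,
    hU, mul_vecMulVec, hUa,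
    vecMulVec_mul, haU, vecMulVec_mul_vecMulVec, haa]
  ext i j
  simp [vecMulVec_apply]
  ring

/-- the GROUSE rank-one update of a matrix with orthonormal columns
again has orthonormal columns, for every step angle `θ`. -/
theorem grouse_update_orthonormal {n d : ℕ}
    (U : Matrix (Fin n) (Fin d) ℝ) (hU : Uᵀ * U = 1)
    (w : Fin d → ℝ) (hw : w ≠ 0)
    (p : Fin n → ℝ) (hp : p = U.mulVec w)
    (r : Fin n → ℝ) (hr : Uᵀ.mulVec r = 0) (hr0 : r ≠ 0)
    (θ : ℝ)
    (Uplus : Matrix (Fin n) (Fin d) ℝ)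
    (hUplus : Uplus = U + Matrix.vecMulVec
      (fun i => Real.cos θ * (p i / l2norm p) + Real.sin θ * (r i / l2norm r)
        - p i / l2norm p)
      (fun j => w j / l2norm w)) :
    Uplusᵀ * Uplus = 1 := by
  have hb := inv_l2norm_smul_dotProduct_self hw
  have hq := inv_l2norm_smul_dotProduct_self hr0
  have hUq : Uᵀ *ᵥ ((l2norm r)⁻¹ • r) = 0 := by rw [mulVec_smul, hr, smul_zero]
  have hUplus' : Uplus = U + vecMulVec ((Real.cos θ - 1) • U *ᵥ ((l2norm w)⁻¹ • w) +
      Real.sin θ • (l2norm r)⁻¹ • r) ((l2norm w)⁻¹ • w) := by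
    rw [hUplus, hp, l2norm_mulVec_of_orthonormal hU, mulVec_smul]
    ext i j
    simp only [Matrix.add_apply, vecMulVec_apply, Pi.add_apply, Pi.smul_apply, smul_eq_mul]
    ring
  rw [hUplus']
  exact rotate_column_direction_orthonormal hU hb hUq hq (Real.cos_sq_add_sin_sq θ)
end

section
/- Let U be an n×d real matrix with orthonormal columns, let A be an m×n real matrix such that AU has full column rank d, and let v ∈ ℝ^n. Set v_∥ = UUᵀv, v_⊥ = v − v_∥, and w_∥ = (UᵀAᵀAU)⁻¹UᵀAᵀA v_∥. Then: (i) U w_∥ = v_∥; and (ii) the GROUSE residual r := Aᵀ(Av − AUw) with w = (UᵀAᵀAU)⁻¹UᵀAᵀAv satisfies r = Aᵀ(A v_⊥ − P_{AU}(A v_⊥)), where P_{AU} is the orthogonal projection of ℝ^m onto the column span of AU. -/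
open Matrix

/-- The Gram matrix of a real matrix of full column rank is invertible. -/
theorem isUnit_transpose_mul_self_of_rank_eq {m d : ℕ} (B : Matrix (Fin m) (Fin d) ℝ)
    (hB : B.rank = d) : IsUnit (Bᵀ * B) := by
  rw [← linearIndependent_cols_iff_isUnit, linearIndependent_iff_card_eq_finrank_span,
    Set.finrank, ← rank_eq_finrank_span_cols, rank_transpose_mul_self, hB, Fintype.card_fin]

/-- for `AU` of full column rank, (i) the least-squares coefficients of
`Av∥` reproduce `v∥`, and (ii) the GROUSE residual `r = Aᵀ(Av − AUw)` equals
`Aᵀ(Av⊥ − P_{AU}(Av⊥))` where `P_{AU} = AU(UᵀAᵀAU)⁻¹UᵀAᵀ` is the orthogonal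
projection onto the column span of `AU`. -/
theorem grouse_undersampled_residual {n d m : ℕ}
    (U : Matrix (Fin n) (Fin d) ℝ) (hU : Uᵀ * U = 1)
    (A : Matrix (Fin m) (Fin n) ℝ) (hrank : (A * U).rank = d)
    (v : Fin n → ℝ)
    (vpar : Fin n → ℝ) (hvpar : vpar = (U * Uᵀ).mulVec v)
    (vperp : Fin n → ℝ) (hvperp : vperp = v - vpar)
    (wpar : Fin d → ℝ)
    (hwpar : wpar = ((Uᵀ * Aᵀ * A * U)⁻¹ * (Uᵀ * Aᵀ * A)).mulVec vpar)
    (w : Fin d → ℝ)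
    (hw : w = ((Uᵀ * Aᵀ * A * U)⁻¹ * (Uᵀ * Aᵀ * A)).mulVec v)
    (r : Fin n → ℝ)
    (hr : r = Aᵀ.mulVec (A.mulVec v - (A * U).mulVec w))
    (P : Matrix (Fin m) (Fin m) ℝ)
    (hP : P = A * U * (Uᵀ * Aᵀ * A * U)⁻¹ * Uᵀ * Aᵀ) :
    U.mulVec wpar = vpar ∧
    r = Aᵀ.mulVec (A.mulVec vperp - P.mulVec (A.mulVec vperp)) := by
  have hunit : IsUnit (Uᵀ * Aᵀ * A * U) := by
    have h := isUnit_transpose_mul_self_of_rank_eq (A * U) hrank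
    simpa only [transpose_mul, ← Matrix.mul_assoc] using h
  have hinv : (Uᵀ * Aᵀ * A * U)⁻¹ * (Uᵀ * Aᵀ * A * U) = 1 :=
    Matrix.nonsing_inv_mul _ ((Matrix.isUnit_iff_isUnit_det _).mp hunit)
  have hwpar' : wpar = Uᵀ *ᵥ v := by
    rw [hwpar, hvpar, mulVec_mulVec, ← Matrix.mul_assoc, Matrix.mul_assoc _ _ U, hinv,
      Matrix.one_mul]
  have hpar : U *ᵥ wpar = vpar := by
    rw [hwpar', hvpar, mulVec_mulVec]
  refine ⟨hpar, ?_⟩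
  have hPU (x : Fin n → ℝ) : P *ᵥ (A *ᵥ x) =
      (A * U) *ᵥ (((Uᵀ * Aᵀ * A * U)⁻¹ * (Uᵀ * Aᵀ * A)) *ᵥ x) := by
    rw [hP, mulVec_mulVec, mulVec_mulVec]
    simp only [Matrix.mul_assoc]
  have hPpar : P *ᵥ (A *ᵥ vpar) = A *ᵥ vpar := by
    rw [hPU, ← hwpar, ← mulVec_mulVec, hpar]
  rw [hr, hw, ← hPU, hvperp, mulVec_sub A, mulVec_sub P, hPpar, sub_sub_sub_cancel_right]
end

section
/- Let Ū and U be n×d real matrices with orthonormal columns, and let μ₀ > 0 be such that every row Ū_i of Ū satisfies ‖Ū_i‖² ≤ d·μ₀/n (i.e. the column space of Ū is μ₀-incoherent). Suppose the principal angles φ_1, …, φ_d between the column spaces of Ū and U satisfy Σ_{k=1}^d sin²φ_k ≤ d·μ₀/(16n); equivalently, d − ‖ŪᵀU‖_F² ≤ d·μ₀/(16n). Then every row U_i of U satisfies ‖U_i‖² ≤ 2·d·μ₀/n (i.e. the column space of U is incoherent with parameter at most 2μ₀). -/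
open Matrix

/-- The squared entries of a row of `A` sum to the diagonal entry of `A * Aᵀ`. -/
theorem Matrix.sum_sq_row_eq_mul_transpose_diag {m n : Type*} [Fintype n]
    (A : Matrix m n ℝ) (i : m) : ∑ j, A i j ^ 2 = (A * Aᵀ) i i := by
  simp [mul_apply, sq]

/-- The squared Frobenius norm of `A` is the trace of `A * Aᵀ`. -/
theorem Matrix.sum_sum_sq_eq_trace_mul_transpose {m n : Type*} [Fintype m] [Fintype n]
    (A : Matrix m n ℝ) : ∑ i, ∑ j, A i j ^ 2 = (A * Aᵀ).trace := by
  simp [trace, sum_sq_row_eq_mul_transpose_diag]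

/-- If `U` has orthonormal columns, then `U * Uᵀ` is idempotent. -/
theorem Matrix.mul_transpose_mul_self_of_orthonormal {m n : Type*} [Fintype m] [Fintype n]
    [DecidableEq n] {U : Matrix m n ℝ} (hU : Uᵀ * U = 1) :
    U * Uᵀ * (U * Uᵀ) = U * Uᵀ := by
  rw [Matrix.mul_assoc, ← Matrix.mul_assoc Uᵀ, hU, Matrix.one_mul]

/-- If `U` has orthonormal columns, then `U` and `U * Uᵀ` have the same row norms. -/
theorem Matrix.sum_sq_row_mul_transpose_of_orthonormal {m n : Type*} [Fintype m] [Fintype n]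
    [DecidableEq n] {U : Matrix m n ℝ} (hU : Uᵀ * U = 1) (i : m) :
    ∑ k, (U * Uᵀ) i k ^ 2 = ∑ j, U i j ^ 2 := by
  rw [sum_sq_row_eq_mul_transpose_diag, sum_sq_row_eq_mul_transpose_diag, transpose_mul,
    transpose_transpose, mul_transpose_mul_self_of_orthonormal hU]

/-- The squared Frobenius distance between the orthogonal projections onto two column spaces is
twice the sum of the squared sines of their principal angles. -/
theorem Matrix.sum_sum_sq_mul_transpose_sub {m n : Type*} [Fintype m] [Fintype n]
    [DecidableEq n] {U V : Matrix m n ℝ} (hU : Uᵀ * U = 1) (hV : Vᵀ * V = 1) :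
    ∑ i, ∑ k, (U * Uᵀ - V * Vᵀ) i k ^ 2 =
      2 * (Fintype.card n - ∑ k, ∑ l, (Vᵀ * U) k l ^ 2) := by
  have trace_proj : ∀ W : Matrix m n ℝ, Wᵀ * W = 1 → (W * Wᵀ).trace = Fintype.card n := by
    intro W hW
    rw [trace_mul_comm, hW, trace_one]
  have trace_cross : (U * Uᵀ * (V * Vᵀ)).trace = (Vᵀ * U * (Uᵀ * V)).trace := by
    rw [← Matrix.mul_assoc, trace_mul_comm]
    simp only [Matrix.mul_assoc]
  rw [sum_sum_sq_eq_trace_mul_transpose, sum_sum_sq_eq_trace_mul_transpose]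
  simp only [transpose_sub, transpose_mul, transpose_transpose, Matrix.mul_sub, Matrix.sub_mul,
    mul_transpose_mul_self_of_orthonormal hU, mul_transpose_mul_self_of_orthonormal hV, trace_sub,
    trace_mul_comm (V * Vᵀ), trace_cross, trace_proj U hU, trace_proj V hV]
  ring

/-- if the column space of `Ū` is `μ₀`-incoherent (every row of `Ū` has
squared norm at most `dμ₀/n`) and `Σ_k sin²φ_k = d − ‖ŪᵀU‖_F² ≤ dμ₀/(16n)`, then
every row of `U` has squared norm at most `2dμ₀/n`. -/
theorem incoherence_of_nearby_subspace {n d : ℕ}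
    (Ubar U : Matrix (Fin n) (Fin d) ℝ)
    (hUbar : Ubarᵀ * Ubar = 1) (hU : Uᵀ * U = 1)
    (μ₀ : ℝ) (hμ₀ : 0 < μ₀)
    (hincoh : ∀ i, ∑ j, Ubar i j ^ 2 ≤ d * μ₀ / n)
    (hclose : (d : ℝ) - ∑ k, ∑ l, ((Ubarᵀ * U) k l) ^ 2 ≤ d * μ₀ / (16 * n)) :
    ∀ i, ∑ j, U i j ^ 2 ≤ 2 * d * μ₀ / n := by
  intro i
  have hdist := sum_sum_sq_mul_transpose_sub hU hUbar
  rw [Fintype.card_fin] at hdist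
  have hrow : ∑ k, (U * Uᵀ - Ubar * Ubarᵀ) i k ^ 2 ≤
      ∑ i, ∑ k, (U * Uᵀ - Ubar * Ubarᵀ) i k ^ 2 :=
    Finset.single_le_sum (f := fun i => ∑ k, (U * Uᵀ - Ubar * Ubarᵀ) i k ^ 2)
      (fun _ _ => Finset.sum_nonneg fun _ _ => sq_nonneg _) (Finset.mem_univ i)
  have hsplit : ∑ k, (U * Uᵀ) i k ^ 2 ≤ 3 / 2 * ∑ k, (Ubar * Ubarᵀ) i k ^ 2 +
      3 * ∑ k, (U * Uᵀ - Ubar * Ubarᵀ) i k ^ 2 := by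
    rw [Finset.mul_sum, Finset.mul_sum, ← Finset.sum_add_distrib]
    refine Finset.sum_le_sum fun k _ => ?_
    rw [Matrix.sub_apply]
    nlinarith [sq_nonneg (2 * (U * Uᵀ) i k - 3 * (Ubar * Ubarᵀ) i k)]
  rw [sum_sq_row_mul_transpose_of_orthonormal hU,
    sum_sq_row_mul_transpose_of_orthonormal hUbar] at hsplit
  have hscale : (d : ℝ) * μ₀ / (16 * n) = d * μ₀ / n / 16 := by ring
  have hdouble : 2 * (d : ℝ) * μ₀ / n = 2 * (d * μ₀ / n) := by ring
  have hnonneg : 0 ≤ (d : ℝ) * μ₀ / n := by positivity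
  linarith [hincoh i]
end
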